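/- For every function f : ℝ⁶ → ℝ and every point p ∈ ℝ⁶, the 3-form ω^f_p = dx^{135} − dx^{146} − dx^{236} + f(p)·dx^{245} is non-degenerate, i.e. the linear map ℝ⁶ → Λ²(ℝ⁶)*, v ↦ ι_v ω^f_p, is injective. -/

import Mathlib

/-- `dx3 i j k` is the alternating 3-form `dxⁱ ∧ dxʲ ∧ dxᵏ` on `ℝ⁶ = Fin 6 → ℝ`. -/
noncomputable def dx3 (i j k : Fin 6) : AlternatingMap ℝ (Fin 6 → ℝ) ℝ (Fin 3) :=
  (Matrix.detRowAlternating : AlternatingMap ℝ (Fin 3 → ℝ) ℝ (Fin 3)).compLinearMap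
    (LinearMap.funLeft ℝ ℝ ![i, j, k])

/-- For `f : ℝ⁶ → ℝ`, the field of 3-forms
`ω^f_p = dx^{135} − dx^{146} − dx^{236} + f(p)·dx^{245}` on `ℝ⁶`. -/
noncomputable def omegaF (f : (Fin 6 → ℝ) → ℝ) (p : Fin 6 → ℝ) :
    AlternatingMap ℝ (Fin 6 → ℝ) ℝ (Fin 3) :=
  dx3 0 2 4 - dx3 0 3 5 - dx3 1 2 5 + f p • dx3 1 3 4

/-- The value of `dxⁱ ∧ dxʲ ∧ dxᵏ` on three vectors is the corresponding `3 × 3` minor. -/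
theorem dx3_apply (i j k : Fin 6) (u v w : Fin 6 → ℝ) :
    dx3 i j k ![u, v, w] =
      u i * v j * w k - u i * v k * w j - u j * v i * w k + u j * v k * w i
        + u k * v i * w j - u k * v j * w i := by
  refine (Matrix.det_fin_three
    (Matrix.of fun m => LinearMap.funLeft ℝ ℝ ![i, j, k] (![u, v, w] m))).trans ?_
  simp [LinearMap.funLeft_apply]

/-- For every `f : ℝ⁶ → ℝ` and every `p`, the 3-form `ω^f_p` is non-degenerate. -/
theorem omegaF_nondegenerate (f : (Fin 6 → ℝ) → ℝ) (p : Fin 6 → ℝ) :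
    Function.Injective (fun v : Fin 6 → ℝ => (omegaF f p).curryLeft v) := by
  intro v w h
  have key (a b : Fin 6) : omegaF f p ![v, Pi.single a 1, Pi.single b 1] =
      omegaF f p ![w, Pi.single a 1, Pi.single b 1] :=
    DFunLike.congr_fun h ![Pi.single a 1, Pi.single b 1]
  simp only [omegaF, AlternatingMap.add_apply, AlternatingMap.sub_apply,
    AlternatingMap.smul_apply, dx3_apply, smul_eq_mul] at key
  have h0 : v 0 = w 0 := by simpa [Pi.single_apply] using key 2 4
  have h1 : v 1 = w 1 := by simpa [Pi.single_apply] using key 2 5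
  have h2 : v 2 = w 2 := by simpa [Pi.single_apply] using key 0 4
  have h3 : v 3 = w 3 := by simpa [Pi.single_apply] using key 0 5
  have h4 : v 4 = w 4 := by simpa [Pi.single_apply] using key 0 2
  have h5 : v 5 = w 5 := by simpa [Pi.single_apply] using key 0 3
  ext m
  fin_cases m <;> assumption
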